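/- Let (X, Y) be a bivariate normal pair with means μ_X, μ_Y, standard deviations σ_X, σ_Y > 0 and correlation ρ ∈ [−1, 1], let c ∈ ℝ with z_c = (c − μ_X)/σ_X, and let W = min(X, c) be the right-censored observation of X at limit c. Then the variance of the conditional expectation of Y given the σ-algebra generated by W satisfies Var(E[Y | σ(W)]) = ρ²·σ_Y²·h(z_c), where h is the censoring adjustment function. -/

import Mathlib

open MeasureTheory ProbabilityTheory Real

/-- The standard normal density. -/
noncomputable def normPDF (t : ℝ) : ℝ := Real.exp (-t ^ 2 / 2) / Real.sqrt (2 * Real.pi)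

/-- The standard normal cumulative distribution function. -/
noncomputable def normCDF (t : ℝ) : ℝ := ∫ s in Set.Iic t, normPDF s

/-- The censoring adjustment function `h(z) = Φ(z) − z·φ(z) + φ(z)²/(1 − Φ(z))`. -/
noncomputable def censorAdj (z : ℝ) : ℝ :=
  normCDF z - z * normPDF z + (normPDF z) ^ 2 / (1 - normCDF z)

/-- The conditional expectation of `X` given the censored observation `min X c`: it is `X` itself
where `X < c`, and the mean of `X` on `{c ≤ X}` elsewhere. -/
theorem condExp_comap_min {Ω : Type*} [MeasurableSpace Ω] {P : Measure Ω} [IsFiniteMeasure P]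
    {X : Ω → ℝ} (hXm : Measurable X) (hX : Integrable X P) (c : ℝ) :
    P[X | MeasurableSpace.comap (fun ω ↦ min (X ω) c) inferInstance] =ᵐ[P] fun ω ↦
      if X ω < c then X ω else (∫ ω in X ⁻¹' Set.Ici c, X ω ∂P) / P.real (X ⁻¹' Set.Ici c) := by
  have hA : MeasurableSet (X ⁻¹' Set.Ici c) := hXm measurableSet_Ici
  set k := (∫ ω in X ⁻¹' Set.Ici c, X ω ∂P) / P.real (X ⁻¹' Set.Ici c) with hk
  have hWm : Measurable fun ω ↦ min (X ω) c := hXm.min measurable_const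
  have hg : Integrable (fun ω ↦ if X ω < c then X ω else k) P :=
    Integrable.piecewise (s := {ω | X ω < c}) (measurableSet_lt hXm measurable_const)
      hX.integrableOn (integrable_const k).integrableOn
  refine (ae_eq_condExp_of_forall_setIntegral_eq hWm.comap_le hX
    (fun s _ _ ↦ hg.integrableOn) ?_ ?_).symm
  · rintro s hs -
    have hs' := hWm.comap_le s hs
    rw [← integral_inter_add_sdiff hA hg.integrableOn, ← integral_inter_add_sdiff hA hX.integrableOn]
    congr 1
    · obtain ⟨B, -, rfl⟩ := hs
      by_cases hc : c ∈ B
      · have hinter : (fun ω ↦ min (X ω) c) ⁻¹' B ∩ X ⁻¹' Set.Ici c = X ⁻¹' Set.Ici c := by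
          refine Set.inter_eq_right.2 fun ω hω ↦ ?_
          simpa [min_eq_right (show c ≤ X ω from hω)] using hc
        rw [hinter, setIntegral_congr_fun (g := fun _ ↦ k) hA
          (fun ω hω ↦ if_neg (not_lt.2 hω)), setIntegral_const, smul_eq_mul]
        by_cases h0 : P.real (X ⁻¹' Set.Ici c) = 0
        · rw [h0, zero_mul, setIntegral_measure_zero _ ((measureReal_eq_zero_iff).1 h0)]
        · rw [hk, mul_div_cancel₀ _ h0]
      · have hinter : (fun ω ↦ min (X ω) c) ⁻¹' B ∩ X ⁻¹' Set.Ici c = ∅ := by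
          refine Set.eq_empty_of_forall_notMem fun ω hω ↦ hc ?_
          simpa [min_eq_right (show c ≤ X ω from hω.2)] using hω.1
        simp [hinter]
    · refine setIntegral_congr_fun (hs'.diff hA) fun ω hω ↦ ?_
      exact if_pos (not_le.1 hω.2)
  · have hφ : Measurable fun w : ℝ ↦ if w < c then w else k :=
      Measurable.ite measurableSet_Iio measurable_id measurable_const
    have hgm := hφ.comp (comap_measurable (fun ω ↦ min (X ω) c))
    convert! hgm.stronglyMeasurable.aestronglyMeasurable using 1
    ext ω
    by_cases h : X ω < c
    · simp [h, min_eq_left h.le]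
    · simp [h]

theorem gaussianPDFReal_zero_one : gaussianPDFReal 0 1 = normPDF := by
  ext t
  simp [gaussianPDFReal, normPDF, div_eq_inv_mul]

theorem normPDF_pos (t : ℝ) : 0 < normPDF t := by
  unfold normPDF
  positivity

theorem integrable_normPDF : Integrable normPDF :=
  gaussianPDFReal_zero_one ▸ integrable_gaussianPDFReal 0 1

theorem hasDerivAt_normPDF (t : ℝ) : HasDerivAt normPDF (-(t * normPDF t)) t := by
  have h : HasDerivAt (fun s : ℝ ↦ -s ^ 2 / 2) (-t) t :=
    (((hasDerivAt_pow 2 t).neg.div_const 2).congr_deriv (by simp; ring))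
  exact (h.exp.div_const (√(2 * π))).congr_deriv (by unfold normPDF; ring)

theorem setIntegral_gaussianReal_zero_one {s : Set ℝ} (hs : MeasurableSet s) (f : ℝ → ℝ) :
    ∫ t in s, f t ∂gaussianReal 0 1 = ∫ t in s, normPDF t * f t := by
  rw [← integral_indicator hs, integral_gaussianReal_eq_integral_smul one_ne_zero,
    gaussianPDFReal_zero_one, ← integral_indicator hs]
  congr 1
  ext t
  by_cases h : t ∈ s <;> simp [h]

theorem tendsto_pow_mul_normPDF_atBot (n : ℕ) :
    Filter.Tendsto (fun t ↦ t ^ n * normPDF t) Filter.atBot (nhds 0) := by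
  have h := (tendsto_rpow_abs_mul_exp_neg_mul_sq_cocompact (a := 1 / 2) (by norm_num) n).mono_left
    atBot_le_cocompact
  refine squeeze_zero_norm (fun t ↦ ?_) (by simpa only [zero_div] using h.div_const (√(2 * π)))
  simp only [normPDF, norm_mul, norm_pow, norm_eq_abs, rpow_natCast, norm_div, abs_exp]
  rw [abs_of_nonneg (Real.sqrt_nonneg _), mul_div_assoc]
  gcongr
  linarith

theorem integrable_pow_gaussianReal (n : ℕ) : Integrable (fun t ↦ t ^ n) (gaussianReal 0 1) := by
  have h := (memLp_id_gaussianReal (μ := 0) (v := 1) n).integrable_norm_pow'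
  exact (integrable_norm_iff (by fun_prop)).1 (by simpa using h)

theorem integrable_normPDF_mul_pow (n : ℕ) : Integrable fun t ↦ normPDF t * t ^ n := by
  have h := integrable_pow_gaussianReal n
  rw [gaussianReal_of_var_ne_zero 0 one_ne_zero,
    integrable_withDensity_iff_integrable_smul' (measurable_gaussianPDF 0 1)
      (by simp [gaussianPDF])] at h
  simpa [gaussianPDF, gaussianPDFReal_nonneg, gaussianPDFReal_zero_one, (normPDF_pos _).le] using h

theorem integral_Iic_normPDF_mul_id (z : ℝ) : ∫ t in Set.Iic z, normPDF t * t = -normPDF z := by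
  have hd (t : ℝ) : HasDerivAt (fun t ↦ -normPDF t) (normPDF t * t) t :=
    (hasDerivAt_normPDF t).neg.congr_deriv (by ring)
  have h := integral_Iic_of_hasDerivAt_of_tendsto' (a := z) (fun t _ ↦ hd t)
    (by simpa using (integrable_normPDF_mul_pow 1).integrableOn)
    (by simpa using (tendsto_pow_mul_normPDF_atBot 0).neg)
  simpa using h

theorem integral_Iic_normPDF_mul_sq (z : ℝ) :
    ∫ t in Set.Iic z, normPDF t * t ^ 2 = normCDF z - z * normPDF z := by
  have hd (t : ℝ) : HasDerivAt (fun t ↦ -(t * normPDF t)) (normPDF t * t ^ 2 - normPDF t) t :=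
    ((hasDerivAt_id t).mul (hasDerivAt_normPDF t)).neg.congr_deriv (by simp; ring)
  have hi := (integrable_normPDF_mul_pow 2).integrableOn (s := Set.Iic z)
  have h := integral_Iic_of_hasDerivAt_of_tendsto' (a := z) (fun t _ ↦ hd t)
    (hi.sub integrable_normPDF.integrableOn)
    (by simpa using (tendsto_pow_mul_normPDF_atBot 1).neg)
  rw [integral_sub hi integrable_normPDF.integrableOn] at h
  unfold normCDF
  linarith

theorem gaussianReal_real_Ici (z : ℝ) : (gaussianReal 0 1).real (Set.Ici z) = 1 - normCDF z := by
  rw [← Set.compl_Iio, probReal_compl_eq_one_sub measurableSet_Iio]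
  have h := setIntegral_gaussianReal_zero_one (measurableSet_Iio (a := z)) fun _ ↦ 1
  rw [setIntegral_const] at h
  simp only [smul_eq_mul, mul_one] at h
  rw [h, ← integral_Iic_eq_integral_Iio, normCDF]

theorem one_sub_normCDF_pos (z : ℝ) : 0 < 1 - normCDF z := by
  rw [← gaussianReal_real_Ici, measureReal_def, ENNReal.toReal_pos_iff]
  refine ⟨pos_iff_ne_zero.2 fun h ↦ ?_, measure_lt_top _ _⟩
  simpa using gaussianReal_absolutelyContinuous' 0 one_ne_zero h

theorem setIntegral_Iio_id_gaussianReal (z : ℝ) :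
    ∫ t in Set.Iio z, t ∂gaussianReal 0 1 = -normPDF z := by
  rw [setIntegral_gaussianReal_zero_one measurableSet_Iio, ← integral_Iic_eq_integral_Iio,
    integral_Iic_normPDF_mul_id]

theorem setIntegral_Iio_sq_gaussianReal (z : ℝ) :
    ∫ t in Set.Iio z, t ^ 2 ∂gaussianReal 0 1 = normCDF z - z * normPDF z := by
  rw [setIntegral_gaussianReal_zero_one measurableSet_Iio, ← integral_Iic_eq_integral_Iio,
    integral_Iic_normPDF_mul_sq]

theorem setIntegral_Ici_id_gaussianReal (z : ℝ) :
    ∫ t in Set.Ici z, t ∂gaussianReal 0 1 = normPDF z := by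
  have h := integral_add_compl (measurableSet_Iio (a := z))
    (by simpa using integrable_pow_gaussianReal 1 : Integrable (fun t : ℝ ↦ t) (gaussianReal 0 1))
  rw [integral_id_gaussianReal, setIntegral_Iio_id_gaussianReal, Set.compl_Iio] at h
  linarith

/-- A standard normal variable whose values above `z` are replaced by their conditional mean. -/
noncomputable def censoredMean (z t : ℝ) : ℝ :=
  if t < z then t else normPDF z / (1 - normCDF z)

theorem memLp_censoredMean (z : ℝ) : MemLp (censoredMean z) 2 (gaussianReal 0 1) :=
  MemLp.piecewise (s := Set.Iio z) measurableSet_Iio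
    ((memLp_id_gaussianReal 2).restrict _) (memLp_const _)

theorem integral_censoredMean (z : ℝ) : ∫ t, censoredMean z t ∂gaussianReal 0 1 = 0 := by
  have hi := (memLp_censoredMean z).integrable one_le_two
  rw [← integral_add_compl (measurableSet_Iio (a := z)) hi, Set.compl_Iio,
    setIntegral_congr_fun (f := censoredMean z) measurableSet_Iio (g := fun t ↦ t)
      (fun t ht ↦ if_pos ht),
    setIntegral_congr_fun (f := censoredMean z) measurableSet_Ici
      (g := fun _ ↦ normPDF z / (1 - normCDF z))
      (fun t ht ↦ if_neg (not_lt.2 ht)),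
    setIntegral_Iio_id_gaussianReal, setIntegral_const, gaussianReal_real_Ici, smul_eq_mul,
    mul_div_cancel₀ _ (one_sub_normCDF_pos z).ne', neg_add_cancel]

theorem integral_censoredMean_sq (z : ℝ) :
    ∫ t, censoredMean z t ^ 2 ∂gaussianReal 0 1 = censorAdj z := by
  have hi := (memLp_censoredMean z).integrable_sq
  rw [← integral_add_compl (measurableSet_Iio (a := z)) hi, Set.compl_Iio,
    setIntegral_congr_fun (f := fun t ↦ censoredMean z t ^ 2) measurableSet_Iio (g := fun t ↦ t ^ 2)
      (fun t ht ↦ congrArg (· ^ 2) (if_pos ht)),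
    setIntegral_congr_fun (f := fun t ↦ censoredMean z t ^ 2) measurableSet_Ici
      (g := fun _ ↦ (normPDF z / (1 - normCDF z)) ^ 2)
      (fun t ht ↦ congrArg (· ^ 2) (if_neg (not_lt.2 ht))),
    setIntegral_Iio_sq_gaussianReal, setIntegral_const, gaussianReal_real_Ici, smul_eq_mul,
    censorAdj]
  have := (one_sub_normCDF_pos z).ne'
  field_simp

/-- The conditional expectation of a standard normal variable given its censoring at `z`. -/
theorem condExp_comap_min_of_map_eq_gaussianReal {Ω : Type*} [MeasurableSpace Ω] {P : Measure Ω}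
    [IsFiniteMeasure P] {Z : Ω → ℝ} (hZm : Measurable Z) (hZ : P.map Z = gaussianReal 0 1) (z : ℝ) :
    P[Z | MeasurableSpace.comap (fun ω ↦ min (Z ω) z) inferInstance] =ᵐ[P]
      fun ω ↦ censoredMean z (Z ω) := by
  have hi : Integrable Z P := by
    have h : Integrable (fun t ↦ t ^ 1) (P.map Z) := hZ ▸ integrable_pow_gaussianReal 1
    simpa [Function.comp_def] using h.comp_measurable hZm
  have hreal : P.real (Z ⁻¹' Set.Ici z) = 1 - normCDF z := by
    rw [← map_measureReal_apply hZm measurableSet_Ici, hZ, gaussianReal_real_Ici]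
  have hint : ∫ ω in Z ⁻¹' Set.Ici z, Z ω ∂P = normPDF z := by
    rw [← setIntegral_map (f := fun t ↦ t) measurableSet_Ici (by fun_prop) hZm.aemeasurable, hZ,
      setIntegral_Ici_id_gaussianReal]
  simpa only [hreal, hint, censoredMean] using condExp_comap_min hZm hi z

/-- For a bivariate normal pair `(X, Y)` and `W = min(X, c)` the right-censored observation,
the variance of the conditional expectation of `Y` given `σ(W)` is
`Var(E[Y | σ(W)]) = ρ²·σY²·h(z_c)`. -/
theorem censored_variance_of_conditional_expectation
    {Ω : Type*} [MeasurableSpace Ω] (P : Measure Ω) [IsProbabilityMeasure P]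
    (X ε Y W : Ω → ℝ) (hXm : Measurable X) (hεm : Measurable ε)
    (μX μY σX σY ρ c : ℝ) (hσX : 0 < σX) (hσY : 0 < σY) (hρ : ρ ∈ Set.Icc (-1 : ℝ) 1)
    (hX : Measure.map X P = gaussianReal μX (Real.toNNReal (σX ^ 2)))
    (hε : Measure.map ε P = gaussianReal 0 (Real.toNNReal ((1 - ρ ^ 2) * σY ^ 2)))
    (hind : IndepFun X ε P)
    (hY : ∀ ω, Y ω = μY + ρ * (σY / σX) * (X ω - μX) + ε ω)
    (hW : ∀ ω, W ω = min (X ω) c) :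
    (∫ ω, ((P[Y | MeasurableSpace.comap W inferInstance]) ω) ^ 2 ∂P)
      - (∫ ω, (P[Y | MeasurableSpace.comap W inferInstance]) ω ∂P) ^ 2
      = ρ ^ 2 * σY ^ 2 * censorAdj ((c - μX) / σX) := by
  set z := (c - μX) / σX with hz
  set Z : Ω → ℝ := fun ω ↦ (X ω - μX) / σX with hZdef
  set b := ρ * σY with hb
  have hZm : Measurable Z := (hXm.sub_const μX).div_const σX
  have hZ : P.map Z = gaussianReal 0 1 := by
    have h : P.map Z = ((P.map X).map (· - μX)).map (· / σX) := by
      rw [Measure.map_map (by fun_prop) (by fun_prop), Measure.map_map (by fun_prop) hXm]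
      rfl
    rw [h, hX, gaussianReal_map_sub_const, gaussianReal_map_div_const, sub_self, zero_div]
    congr 1
    ext
    simp [hσX.ne', sq_nonneg]
  have hcomap : MeasurableSpace.comap W inferInstance
      = MeasurableSpace.comap (fun ω ↦ min (Z ω) z) inferInstance := by
    have hZW (ω : Ω) : min (Z ω) z = (W ω - μX) / σX := by
      rw [hW, hz, hZdef, min_div_div_right hσX.le, min_sub_sub_right]
    apply le_antisymm
    · have hWZ : W = (fun w ↦ σX * w + μX) ∘ fun ω ↦ min (Z ω) z := by
        ext ω
        simp only [Function.comp_apply, hZW]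
        field_simp
        ring
      rw [hWZ]
      exact (Measurable.comp (by fun_prop) (comap_measurable _)).comap_le
    · simp_rw [hZW]
      exact (((comap_measurable W).sub_const μX).div_const σX).comap_le
  have hWm : Measurable W := by
    rw [show W = fun ω ↦ min (X ω) c from funext hW]
    exact hXm.min measurable_const
  have hZi : Integrable Z P := by
    have h : Integrable (fun t ↦ t ^ 1) (P.map Z) := hZ ▸ integrable_pow_gaussianReal 1
    simpa [Function.comp_def] using h.comp_measurable hZm
  have hεi : Integrable ε P := by
    have h : Integrable (id : ℝ → ℝ) (P.map ε) :=
      hε ▸ (memLp_id_gaussianReal 1).integrable le_rfl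
    exact h.comp_measurable hεm
  have hε0 : ∫ ω, ε ω ∂P = 0 := by
    rw [← integral_map (f := fun t ↦ t) hεm.aemeasurable (by fun_prop), hε,
      integral_id_gaussianReal]
  have hcondε : P[ε | .comap W inferInstance] =ᵐ[P] fun _ ↦ 0 := by
    have hεW : IndepFun ε W P := by
      rw [show W = (fun x ↦ min x c) ∘ X from funext hW]
      exact hind.symm.comp measurable_id (by fun_prop)
    rw [← hε0]
    exact condExp_indep_eq hεm.comap_le hWm.comap_le
      (comap_measurable ε).stronglyMeasurable ((IndepFun_iff_Indep ..).1 hεW)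
  have hcond : P[Y | .comap W inferInstance] =ᵐ[P] fun ω ↦ μY + b * censoredMean z (Z ω) := by
    have hYeq : Y = ((fun _ ↦ μY) + b • Z) + ε := by
      ext ω
      simp only [hY, hb, hZdef, Pi.add_apply, Pi.smul_apply, smul_eq_mul]
      ring
    have hcondZ := condExp_comap_min_of_map_eq_gaussianReal hZm hZ z
    rw [← hcomap] at hcondZ
    rw [hYeq]
    filter_upwards [condExp_add ((integrable_const μY).add (hZi.smul b)) hεi _,
      condExp_add (integrable_const μY) (hZi.smul b) _,
      condExp_smul (μ := P) b Z (.comap W inferInstance), hcondZ, hcondε]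
      with ω h₁ h₂ h₃ h₄ h₅
    rw [h₁, Pi.add_apply, h₂, Pi.add_apply, h₃, Pi.smul_apply, h₄, h₅,
      condExp_const hWm.comap_le, smul_eq_mul, add_zero]
  have hgi := (memLp_censoredMean z).integrable one_le_two
  have hgi2 := (memLp_censoredMean z).integrable_sq
  have hmean : ∫ ω, (P[Y | .comap W inferInstance]) ω ∂P = μY := by
    rw [integral_congr_ae hcond, ← integral_map (f := fun t ↦ μY + b * censoredMean z t)
      hZm.aemeasurable (hZ ▸ (hgi.const_mul b).aestronglyMeasurable.const_add μY), hZ,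
      integral_add (integrable_const μY) (hgi.const_mul b), integral_const_mul,
      integral_censoredMean]
    simp
  have hsq : ∫ ω, (P[Y | .comap W inferInstance]) ω ^ 2 ∂P = μY ^ 2 + b ^ 2 * censorAdj z := by
    have hexp (t : ℝ) : (μY + b * censoredMean z t) ^ 2
        = (μY ^ 2 + 2 * μY * b * censoredMean z t) + b ^ 2 * censoredMean z t ^ 2 := by ring
    have h₁ : Integrable (fun t ↦ μY ^ 2 + 2 * μY * b * censoredMean z t) (gaussianReal 0 1) :=
      (integrable_const _).add (hgi.const_mul _)
    have hcond2 : (fun ω ↦ (P[Y | .comap W inferInstance]) ω ^ 2) =ᵐ[P]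
        fun ω ↦ (μY + b * censoredMean z (Z ω)) ^ 2 := hcond.fun_comp (· ^ 2)
    rw [integral_congr_ae hcond2,
      ← integral_map (f := fun t ↦ (μY + b * censoredMean z t) ^ 2)
      hZm.aemeasurable (by rw [hZ]; simp_rw [hexp]; exact (h₁.add (hgi2.const_mul _)).1), hZ]
    simp_rw [hexp]
    rw [integral_add h₁ (hgi2.const_mul _), integral_add (integrable_const _) (hgi.const_mul _),
      integral_const_mul, integral_const_mul, integral_censoredMean, integral_censoredMean_sq]
    simp
  rw [hmean, hsq, hb]
  ring
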